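/- Let c, d > 0 with 1/c + 1/d ≥ 1 and define g(x) = x·F(c,d;c+d;x) for x ∈ (0,1). Then for every x ∈ (0,1) and all real p, q, g(x^p/(1+x^p)) · g(x^q/(1+x^q)) ≤ ( g(x^{(p+q)/2}/(1+x^{(p+q)/2})) )². -/

import Mathlib

/-- The Gaussian hypergeometric function `₂F₁(a,b;c;x)` defined by its Maclaurin
series `∑ (a)ₙ(b)ₙ/((c)ₙ n!) xⁿ`, where `(a)ₙ` is the rising factorial. -/
noncomputable def hypergeom (a b c x : ℝ) : ℝ :=
  ∑' n : ℕ, ((∏ k ∈ Finset.range n, (a + k)) * (∏ k ∈ Finset.range n, (b + k)) /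
      ((∏ k ∈ Finset.range n, (c + k)) * (Nat.factorial n))) * x ^ n

open Set

theorem summable_mul_pow_of_abs_le {a : ℕ → ℝ} {C : ℝ} (ha : ∀ n, |a n| ≤ C) {y : ℝ}
    (hy : |y| < 1) : Summable fun n => a n * y ^ n := by
  refine Summable.of_norm_bounded ((summable_geometric_of_lt_one (abs_nonneg y) hy).mul_left C) ?_
  intro n
  rw [norm_mul, norm_pow, Real.norm_eq_abs, Real.norm_eq_abs]
  exact mul_le_mul_of_nonneg_right (ha n) (by positivity)

theorem summable_nat_mul_mul_pow_of_abs_le {a : ℕ → ℝ} {C : ℝ} (ha : ∀ n, |a n| ≤ C) {y : ℝ}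
    (hy : |y| < 1) : Summable fun n => n * a n * y ^ n := by
  have h := (summable_pow_mul_geometric_of_norm_lt_one 1 (r := |y|) (by simpa using hy)).mul_left C
  refine Summable.of_norm_bounded h fun n => ?_
  rw [norm_mul, norm_mul, norm_pow, Real.norm_eq_abs, Real.norm_eq_abs, Real.norm_eq_abs,
    Nat.abs_cast, pow_one]
  calc n * |a n| * |y| ^ n ≤ n * C * |y| ^ n := by gcongr; exact ha n
    _ = _ := by ring

/-- A power series with bounded coefficients may be differentiated termwise on `(-1, 1)`. -/
theorem hasDerivAt_tsum_mul_pow {a : ℕ → ℝ} {C : ℝ} (ha : ∀ n, |a n| ≤ C) {y : ℝ}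
    (hy : |y| < 1) :
    HasDerivAt (fun x => ∑' n, a n * x ^ n) (∑' n, a n * (n * y ^ (n - 1))) y := by
  obtain ⟨r, hyr, hr⟩ := exists_between hy
  have hr0 : 0 < r := (abs_nonneg y).trans_lt hyr
  have hu : Summable fun n : ℕ => C * (n * r ^ (n - 1)) := by
    refine Summable.mul_left _ ?_
    have h := (summable_pow_mul_geometric_of_norm_lt_one 1 (r := r)
      (by rwa [Real.norm_of_nonneg hr0.le])).mul_left r⁻¹
    refine h.congr fun n => ?_
    rcases n with _ | n
    · simp
    · simp only [pow_succ, Nat.add_sub_cancel]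
      field_simp
  refine hasDerivAt_tsum_of_isPreconnected (t := Ioo (-r) r) (y₀ := 0)
    (g := fun n x => a n * x ^ n) (g' := fun n x => a n * (n * x ^ (n - 1))) hu isOpen_Ioo
    isPreconnected_Ioo (fun n x _ => (hasDerivAt_pow n x).const_mul (a n)) ?_
    ⟨neg_lt_zero.2 hr0, hr0⟩ (summable_mul_pow_of_abs_le ha (by simp)) (abs_lt.1 hyr)
  intro n x hx
  rw [norm_mul, norm_mul, norm_pow, Real.norm_eq_abs, Real.norm_eq_abs, Real.norm_eq_abs,
    Nat.abs_cast]
  have hxr : |x| ≤ r := (abs_lt.2 hx).le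
  have hC : 0 ≤ C := (abs_nonneg _).trans (ha 0)
  gcongr
  exact ha n

theorem mul_deriv_tsum_mul_pow {a : ℕ → ℝ} {C : ℝ} (ha : ∀ n, |a n| ≤ C) {y : ℝ}
    (hy : |y| < 1) :
    y * deriv (fun x => ∑' n, a n * x ^ n) y = ∑' n, n * a n * y ^ n := by
  rw [(hasDerivAt_tsum_mul_pow ha hy).deriv, ← tsum_mul_left]
  refine tsum_congr fun n => ?_
  rcases n with _ | n
  · simp
  · rw [Nat.add_sub_cancel, pow_succ]
    ring

theorem tsum_mul_zero_pow (a : ℕ → ℝ) : ∑' n, a n * (0 : ℝ) ^ n = a 0 := by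
  rw [tsum_eq_single 0 fun n hn => by simp [hn]]
  simp

/-- The Maclaurin coefficients of `₂F₁(c,d;c+d;x)`. -/
noncomputable def zeroBalancedCoeff (c d : ℝ) (n : ℕ) : ℝ :=
  (∏ k ∈ Finset.range n, (c + k)) * (∏ k ∈ Finset.range n, (d + k)) /
    ((∏ k ∈ Finset.range n, (c + d + k)) * (Nat.factorial n))

/-- The function `(1 - x) F'(x)` for `F = ₂F₁(c,d;c+d;·)`, given by its Maclaurin series. -/
noncomputable def zeroBalancedDerivAux (c d x : ℝ) : ℝ :=
  ∑' n : ℕ, zeroBalancedCoeff c d n * (c * d / (c + d + n)) * x ^ n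

section ZeroBalanced

variable {c d : ℝ}

theorem zeroBalancedCoeff_zero : zeroBalancedCoeff c d 0 = 1 := by
  simp [zeroBalancedCoeff]

theorem zeroBalancedCoeff_succ (hc : 0 < c) (hd : 0 < d) (n : ℕ) :
    (n + 1) * zeroBalancedCoeff c d (n + 1) =
      zeroBalancedCoeff c d n * ((c + n) * (d + n) / (c + d + n)) := by
  have h : (∏ k ∈ Finset.range n, (c + d + k)) ≠ 0 :=
    Finset.prod_ne_zero_iff.2 fun k _ => by positivity
  have h' : c + d + n ≠ 0 := by positivity
  simp only [zeroBalancedCoeff, Finset.prod_range_succ, Nat.factorial_succ, Nat.cast_mul,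
    Nat.cast_add, Nat.cast_one]
  field_simp

theorem zeroBalancedCoeff_pos (hc : 0 < c) (hd : 0 < d) (n : ℕ) :
    0 < zeroBalancedCoeff c d n := by
  unfold zeroBalancedCoeff
  have h (e : ℝ) (he : 0 < e) : 0 < ∏ k ∈ Finset.range n, (e + k) :=
    Finset.prod_pos fun k _ => by positivity
  have := h c hc
  have := h d hd
  have := h (c + d) (by positivity)
  positivity

theorem abs_zeroBalancedCoeff_le (hc : 0 < c) (hd : 0 < d) (hcd : c * d ≤ c + d) (n : ℕ) :
    |zeroBalancedCoeff c d n| ≤ 1 := by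
  rw [abs_of_pos (zeroBalancedCoeff_pos hc hd n)]
  induction n with
  | zero => rw [zeroBalancedCoeff_zero]
  | succ n ih =>
    have h := zeroBalancedCoeff_succ hc hd n
    have h1 : (c + n) * (d + n) / (c + d + n) ≤ n + 1 := by
      rw [div_le_iff₀ (by positivity)]
      nlinarith
    have h2 := mul_le_mul ih h1 (by positivity) zero_le_one
    have : (0 : ℝ) < n + 1 := by positivity
    nlinarith

theorem abs_zeroBalancedDerivAux_coeff_le (hc : 0 < c) (hd : 0 < d) (hcd : c * d ≤ c + d)
    (n : ℕ) : |zeroBalancedCoeff c d n * (c * d / (c + d + n))| ≤ 1 := by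
  have h : c * d / (c + d + n) ≤ 1 := by
    rw [div_le_one (by positivity)]
    linarith [n.cast_nonneg (α := ℝ)]
  rw [abs_mul, abs_of_pos (show 0 < c * d / (c + d + n) by positivity)]
  exact mul_le_one₀ (abs_zeroBalancedCoeff_le hc hd hcd n) (by positivity) h

theorem hypergeom_add_eq (c d x : ℝ) :
    hypergeom c d (c + d) x = ∑' n, zeroBalancedCoeff c d n * x ^ n := rfl

theorem hypergeom_add_zero (c d : ℝ) : hypergeom c d (c + d) 0 = 1 := by
  rw [hypergeom_add_eq, tsum_mul_zero_pow, zeroBalancedCoeff_zero]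

theorem zeroBalancedDerivAux_zero (c d : ℝ) :
    zeroBalancedDerivAux c d 0 = c * d / (c + d) := by
  simp [zeroBalancedDerivAux, tsum_mul_zero_pow, zeroBalancedCoeff_zero]

theorem differentiableAt_hypergeom_add (hc : 0 < c) (hd : 0 < d) (hcd : c * d ≤ c + d) {y : ℝ}
    (hy : |y| < 1) : DifferentiableAt ℝ (hypergeom c d (c + d)) y :=
  (hasDerivAt_tsum_mul_pow (abs_zeroBalancedCoeff_le hc hd hcd) hy).differentiableAt

theorem differentiableAt_zeroBalancedDerivAux (hc : 0 < c) (hd : 0 < d) (hcd : c * d ≤ c + d)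
    {y : ℝ} (hy : |y| < 1) : DifferentiableAt ℝ (zeroBalancedDerivAux c d) y :=
  (hasDerivAt_tsum_mul_pow (abs_zeroBalancedDerivAux_coeff_le hc hd hcd) hy).differentiableAt

/-- `(1 - y) F'(y)` is the series `zeroBalancedDerivAux`. -/
theorem hasDerivAt_hypergeom_add (hc : 0 < c) (hd : 0 < d) (hcd : c * d ≤ c + d) {y : ℝ}
    (hy0 : 0 < y) (hy1 : y < 1) :
    HasDerivAt (hypergeom c d (c + d)) (zeroBalancedDerivAux c d y / (1 - y)) y := by
  have hy : |y| < 1 := abs_lt.2 ⟨by linarith, hy1⟩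
  have hs := summable_nat_mul_mul_pow_of_abs_le (abs_zeroBalancedCoeff_le hc hd hcd) hy
  have hG := summable_mul_pow_of_abs_le (abs_zeroBalancedDerivAux_coeff_le hc hd hcd) hy
  have h := mul_deriv_tsum_mul_pow (abs_zeroBalancedCoeff_le hc hd hcd) hy
  have key : ∑' n : ℕ, n * zeroBalancedCoeff c d n * y ^ n =
      y * ∑' n : ℕ, n * zeroBalancedCoeff c d n * y ^ n + y * zeroBalancedDerivAux c d y := by
    rw [zeroBalancedDerivAux, ← mul_add, ← hs.tsum_add hG, ← tsum_mul_left,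
      hs.tsum_eq_zero_add, Nat.cast_zero, zero_mul, zero_mul, zero_add]
    refine tsum_congr fun n => ?_
    rw [Nat.cast_succ, zeroBalancedCoeff_succ hc hd, pow_succ]
    have : c + d + n ≠ 0 := by positivity
    field_simp
    ring
  rw [← h] at key
  have hd' : deriv (hypergeom c d (c + d)) y = zeroBalancedDerivAux c d y / (1 - y) := by
    rw [eq_div_iff (by linarith)]
    refine mul_left_cancel₀ hy0.ne' ?_
    change y * (deriv (fun x => ∑' n, zeroBalancedCoeff c d n * x ^ n) y * (1 - y)) = _
    linear_combination key
  rw [← hd']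
  exact (differentiableAt_hypergeom_add hc hd hcd hy).hasDerivAt

/-- The hypergeometric differential equation, written for `G(y) = (1 - y) F'(y)`. -/
theorem hasDerivAt_zeroBalancedDerivAux (hc : 0 < c) (hd : 0 < d) (hcd : c * d ≤ c + d) {y : ℝ}
    (hy0 : 0 < y) (hy1 : y < 1) :
    HasDerivAt (zeroBalancedDerivAux c d)
      ((c * d * hypergeom c d (c + d) y - (c + d) * zeroBalancedDerivAux c d y) / y) y := by
  have hy : |y| < 1 := abs_lt.2 ⟨by linarith, hy1⟩
  have hb := abs_zeroBalancedDerivAux_coeff_le hc hd hcd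
  have hs := summable_nat_mul_mul_pow_of_abs_le hb hy
  have hG := summable_mul_pow_of_abs_le hb hy
  have h := mul_deriv_tsum_mul_pow hb hy
  have key : ∑' n : ℕ, n * (zeroBalancedCoeff c d n * (c * d / (c + d + n))) * y ^ n +
      (c + d) * zeroBalancedDerivAux c d y = c * d * hypergeom c d (c + d) y := by
    rw [zeroBalancedDerivAux, hypergeom_add_eq, ← tsum_mul_left, ← tsum_mul_left,
      ← hs.tsum_add (hG.mul_left _)]
    refine tsum_congr fun n => ?_
    have : c + d + n ≠ 0 := by positivity
    field_simp
    ring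
  have hd' : deriv (zeroBalancedDerivAux c d) y =
      (c * d * hypergeom c d (c + d) y - (c + d) * zeroBalancedDerivAux c d y) / y := by
    rw [eq_div_iff hy0.ne', ← key, ← h]
    change _ = y * deriv (zeroBalancedDerivAux c d) y + _ - _
    ring
  rw [← hd']
  exact (differentiableAt_zeroBalancedDerivAux hc hd hcd hy).hasDerivAt

theorem hypergeom_add_pos (hc : 0 < c) (hd : 0 < d) (hcd : c * d ≤ c + d) {y : ℝ}
    (hy0 : 0 < y) (hy1 : y < 1) : 0 < hypergeom c d (c + d) y := by
  rw [hypergeom_add_eq]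
  have hy : |y| < 1 := abs_lt.2 ⟨by linarith, hy1⟩
  exact (summable_mul_pow_of_abs_le (abs_zeroBalancedCoeff_le hc hd hcd) hy).tsum_pos
    (fun n => (mul_pos (zeroBalancedCoeff_pos hc hd n) (pow_pos hy0 n)).le) 0
    (mul_pos (zeroBalancedCoeff_pos hc hd 0) (pow_pos hy0 0))

theorem zeroBalancedDerivAux_nonneg (hc : 0 < c) (hd : 0 < d) {y : ℝ} (hy0 : 0 < y) :
    0 ≤ zeroBalancedDerivAux c d y :=
  tsum_nonneg fun n => by
    have := zeroBalancedCoeff_pos hc hd n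
    positivity

theorem zeroBalancedDerivAux_le (hc : 0 < c) (hd : 0 < d) (hcd : c * d ≤ c + d) {y : ℝ}
    (hy0 : 0 < y) (hy1 : y < 1) :
    zeroBalancedDerivAux c d y ≤ c * d / (c + d) * hypergeom c d (c + d) y := by
  have hy : |y| < 1 := abs_lt.2 ⟨by linarith, hy1⟩
  rw [zeroBalancedDerivAux, hypergeom_add_eq, ← tsum_mul_left]
  refine (summable_mul_pow_of_abs_le (abs_zeroBalancedDerivAux_coeff_le hc hd hcd) hy).tsum_le_tsum
    (fun n => ?_)
    ((summable_mul_pow_of_abs_le (abs_zeroBalancedCoeff_le hc hd hcd) hy).mul_left _)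
  have := zeroBalancedCoeff_pos hc hd n
  rw [mul_comm (zeroBalancedCoeff c d n), mul_assoc]
  have : c * d / (c + d + n) ≤ c * d / (c + d) :=
    div_le_div_of_nonneg_left (by positivity) (by positivity) (by linarith [n.cast_nonneg (α := ℝ)])
  gcongr

/-- The quadratic form in `F` and `G = (1 - y) F'` whose sign governs the monotonicity of
`(1 - y) (y F)' / F`. -/
noncomputable def zeroBalancedForm (c d y : ℝ) : ℝ :=
  (c + d - 1) * hypergeom c d (c + d) y * zeroBalancedDerivAux c d y +
    y / (1 - y) * zeroBalancedDerivAux c d y ^ 2 - (c * d - 1) * hypergeom c d (c + d) y ^ 2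

theorem zeroBalancedForm_nonneg_of_add_le_one (hc : 0 < c) (hd : 0 < d) (hcd : c * d ≤ c + d)
    (h1 : c + d ≤ 1) {y : ℝ} (hy0 : 0 < y) (hy1 : y < 1) : 0 ≤ zeroBalancedForm c d y := by
  have hF := hypergeom_add_pos hc hd hcd hy0 hy1
  have hG := zeroBalancedDerivAux_le hc hd hcd hy0 hy1
  unfold zeroBalancedForm
  set F := hypergeom c d (c + d) y
  set G := zeroBalancedDerivAux c d y
  have hy : 0 ≤ y / (1 - y) * G ^ 2 :=
    mul_nonneg (div_nonneg hy0.le (by linarith)) (sq_nonneg _)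
  have h2 : (1 - (c + d)) * F * G ≤ (1 - (c + d)) * F * (c * d / (c + d) * F) :=
    mul_le_mul_of_nonneg_left hG (mul_nonneg (by linarith) hF.le)
  have h3 : (1 - (c + d)) * F * (c * d / (c + d) * F) = (c * d / (c + d) - c * d) * F ^ 2 := by
    field_simp
  have h4 : c * d / (c + d) ≤ 1 := (div_le_one (by positivity)).2 hcd
  nlinarith [mul_nonneg (sub_nonneg.2 h4) (sq_nonneg F)]

theorem hasDerivAt_rpow_mul_zeroBalancedForm (hc : 0 < c) (hd : 0 < d) (hcd : c * d ≤ c + d)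
    {y : ℝ} (hy0 : 0 < y) (hy1 : y < 1) :
    HasDerivAt (fun x => x ^ (c + d - 1) * zeroBalancedForm c d x)
      (y ^ (c + d - 1) / y *
        (((c + d - 1) * hypergeom c d (c + d) y +
            2 * (y / (1 - y)) * zeroBalancedDerivAux c d y) *
          (hypergeom c d (c + d) y - zeroBalancedDerivAux c d y) +
        y / (1 - y) ^ 2 * zeroBalancedDerivAux c d y ^ 2)) y := by
  have hF := hasDerivAt_hypergeom_add hc hd hcd hy0 hy1
  have hG := hasDerivAt_zeroBalancedDerivAux hc hd hcd hy0 hy1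
  have hy1' : 1 - y ≠ 0 := by linarith
  have hz := (hasDerivAt_id y).div ((hasDerivAt_id y).const_sub 1) hy1'
  have hr := Real.hasDerivAt_rpow_const (x := y) (p := c + d - 1) (Or.inl hy0.ne')
  have h := hr.mul ((((hF.const_mul (c + d - 1)).mul hG).add (hz.mul (hG.pow 2))).sub
    ((hF.pow 2).const_mul (c * d - 1)))
  refine h.congr_deriv ?_
  rw [Real.rpow_sub_one hy0.ne' (c + d - 1)]
  simp only [Pi.add_apply, Pi.mul_apply, Pi.sub_apply, Pi.pow_apply, Pi.div_apply, id]
  field_simp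
  ring

theorem zeroBalancedForm_nonneg_of_one_le_add (hc : 0 < c) (hd : 0 < d) (hcd : c * d ≤ c + d)
    (h1 : 1 ≤ c + d) {y : ℝ} (hy0 : 0 < y) (hy1 : y < 1) : 0 ≤ zeroBalancedForm c d y := by
  have habs {x : ℝ} (hx : x ∈ Ico (0 : ℝ) 1) : |x| < 1 := abs_lt.2 ⟨by linarith [hx.1], hx.2⟩
  have hFc : ContinuousOn (hypergeom c d (c + d)) (Ico 0 1) := fun x hx =>
    (differentiableAt_hypergeom_add hc hd hcd (habs hx)).continuousAt.continuousWithinAt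
  have hGc : ContinuousOn (zeroBalancedDerivAux c d) (Ico 0 1) := fun x hx =>
    (differentiableAt_zeroBalancedDerivAux hc hd hcd (habs hx)).continuousAt.continuousWithinAt
  have hzc : ContinuousOn (fun x : ℝ => x / (1 - x)) (Ico 0 1) :=
    continuousOn_id.div (continuousOn_const.sub continuousOn_id) fun x hx => by
      have := hx.2
      linarith
  have hcont : ContinuousOn (fun x => x ^ (c + d - 1) * zeroBalancedForm c d x) (Ico 0 1) :=
    (continuousOn_id.rpow_const fun _ _ => Or.inr (by linarith)).mul
      ((((continuousOn_const.mul hFc).mul hGc).add (hzc.mul (hGc.pow 2))).sub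
        (continuousOn_const.mul (hFc.pow 2)))
  have hmono := monotoneOn_of_deriv_nonneg (convex_Ico 0 1) hcont
    (by
      rw [interior_Ico]
      exact fun x hx => (hasDerivAt_rpow_mul_zeroBalancedForm hc hd hcd hx.1
        hx.2).differentiableAt.differentiableWithinAt)
    (by
      rw [interior_Ico]
      rintro x ⟨hx0, hx1⟩
      rw [(hasDerivAt_rpow_mul_zeroBalancedForm hc hd hcd hx0 hx1).deriv]
      have hF := hypergeom_add_pos hc hd hcd hx0 hx1
      have hG := zeroBalancedDerivAux_nonneg hc hd hx0
      have hGF := zeroBalancedDerivAux_le hc hd hcd hx0 hx1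
      have h4 : c * d / (c + d) ≤ 1 := (div_le_one (by positivity)).2 hcd
      have hGF' : 0 ≤ hypergeom c d (c + d) x - zeroBalancedDerivAux c d x := by nlinarith
      have h1x : 0 < 1 - x := by linarith
      have hS : 0 ≤ c + d - 1 := by linarith
      positivity)
  have h0 : 0 ≤ zeroBalancedForm c d 0 := by
    have : zeroBalancedForm c d 0 = 1 - c * d / (c + d) := by
      rw [zeroBalancedForm, hypergeom_add_zero, zeroBalancedDerivAux_zero]
      field_simp
      ring
    rw [this, sub_nonneg, div_le_one (by positivity)]
    exact hcd
  have h := hmono ⟨le_rfl, zero_lt_one⟩ ⟨hy0.le, hy1⟩ hy0.le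
  exact nonneg_of_mul_nonneg_right
    ((mul_nonneg (Real.rpow_nonneg le_rfl _) h0).trans h) (Real.rpow_pos_of_pos hy0 _)

theorem zeroBalancedForm_nonneg (hc : 0 < c) (hd : 0 < d) (hcd : c * d ≤ c + d) {y : ℝ}
    (hy0 : 0 < y) (hy1 : y < 1) : 0 ≤ zeroBalancedForm c d y :=
  (le_total (c + d) 1).elim
    (fun h => zeroBalancedForm_nonneg_of_add_le_one hc hd hcd h hy0 hy1)
    (fun h => zeroBalancedForm_nonneg_of_one_le_add hc hd hcd h hy0 hy1)

/-- The quotient `(1 - y) (y F)' / F` is decreasing on `(0, 1)`. -/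
theorem antitoneOn_one_sub_add_mul_zeroBalancedDerivAux_div (hc : 0 < c) (hd : 0 < d)
    (hcd : c * d ≤ c + d) :
    AntitoneOn (fun y => 1 - y + y * (zeroBalancedDerivAux c d y / hypergeom c d (c + d) y))
      (Ioo 0 1) := by
  have hderiv {y : ℝ} (hy : y ∈ Ioo (0 : ℝ) 1) :
      HasDerivAt (fun y => 1 - y + y * (zeroBalancedDerivAux c d y / hypergeom c d (c + d) y))
        (-(zeroBalancedForm c d y / hypergeom c d (c + d) y ^ 2)) y := by
    have hF := hasDerivAt_hypergeom_add hc hd hcd hy.1 hy.2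
    have hG := hasDerivAt_zeroBalancedDerivAux hc hd hcd hy.1 hy.2
    have hF0 := (hypergeom_add_pos hc hd hcd hy.1 hy.2).ne'
    refine (((hasDerivAt_id y).const_sub 1).add
      ((hasDerivAt_id y).mul (hG.div hF hF0))).congr_deriv ?_
    have hy0 : y ≠ 0 := hy.1.ne'
    have hy1 : 1 - y ≠ 0 := by linarith [hy.2]
    simp only [Pi.div_apply, id, zeroBalancedForm]
    field_simp
    ring
  refine antitoneOn_of_deriv_nonpos (convex_Ioo 0 1)
    (fun y hy => (hderiv hy).continuousAt.continuousWithinAt)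
    (fun y hy => (hderiv (interior_subset hy)).differentiableAt.differentiableWithinAt) ?_
  intro y hy
  have hy := interior_subset hy
  rw [(hderiv hy).deriv]
  exact neg_nonpos.2 (div_nonneg (zeroBalancedForm_nonneg hc hd hcd hy.1 hy.2) (sq_nonneg _))

theorem concaveOn_log_mul_hypergeom_sigmoid (hc : 0 < c) (hd : 0 < d) (hcd : c * d ≤ c + d) :
    ConcaveOn ℝ univ fun t =>
      Real.log (Real.sigmoid t * hypergeom c d (c + d) (Real.sigmoid t)) := by
  have hderiv (t : ℝ) : HasDerivAt
      (fun t => Real.log (Real.sigmoid t * hypergeom c d (c + d) (Real.sigmoid t)))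
      (1 - Real.sigmoid t + Real.sigmoid t *
        (zeroBalancedDerivAux c d (Real.sigmoid t) / hypergeom c d (c + d) (Real.sigmoid t)))
      t := by
    have h0 := Real.sigmoid_pos t
    have h1 := Real.sigmoid_lt_one t
    have hF0 := hypergeom_add_pos hc hd hcd h0 h1
    have hs := Real.hasDerivAt_sigmoid t
    have hF := (hasDerivAt_hypergeom_add hc hd hcd h0 h1).comp t hs
    refine ((hs.mul hF).log (mul_pos h0 hF0).ne').congr_deriv ?_
    have h1' : 1 - Real.sigmoid t ≠ 0 := by linarith
    simp only [Function.comp, Pi.mul_apply]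
    field_simp
  refine Antitone.concaveOn_univ_of_deriv (fun t => (hderiv t).differentiableAt) ?_
  intro s t hst
  rw [(hderiv s).deriv, (hderiv t).deriv]
  exact antitoneOn_one_sub_add_mul_zeroBalancedDerivAux_div hc hd hcd
    ⟨Real.sigmoid_pos s, Real.sigmoid_lt_one s⟩ ⟨Real.sigmoid_pos t, Real.sigmoid_lt_one t⟩
    (Real.sigmoid_le hst)

end ZeroBalanced

theorem rpow_div_one_add_rpow_eq_sigmoid {x : ℝ} (hx : 0 < x) (p : ℝ) :
    x ^ p / (1 + x ^ p) = Real.sigmoid (p * Real.log x) := by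
  rw [Real.sigmoid_def, Real.exp_neg, mul_comm, ← Real.rpow_def_of_pos hx]
  have := Real.rpow_pos_of_pos hx p
  field_simp
  ring

/-- Remark 4.6 (first corollary): for `c, d > 0` with `1/c + 1/d ≥ 1` and
`g(x) = x·F(c,d;c+d;x)`, the function `p ↦ g(x^p/(1+x^p))` is log-concave in `p`:
`g(x^p/(1+x^p))·g(x^q/(1+x^q)) ≤ g(x^{(p+q)/2}/(1+x^{(p+q)/2}))²` for `x ∈ (0,1)`
and all real `p, q`. -/
theorem hypergeom_log_concave_in_p (c d : ℝ) (hc : 0 < c) (hd : 0 < d)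
    (hcd : 1 ≤ 1 / c + 1 / d) (x : ℝ) (hx0 : 0 < x) (hx1 : x < 1) (p q : ℝ) :
    x ^ p / (1 + x ^ p) * hypergeom c d (c + d) (x ^ p / (1 + x ^ p)) *
        (x ^ q / (1 + x ^ q) * hypergeom c d (c + d) (x ^ q / (1 + x ^ q))) ≤
      (x ^ ((p + q) / 2) / (1 + x ^ ((p + q) / 2)) *
        hypergeom c d (c + d) (x ^ ((p + q) / 2) / (1 + x ^ ((p + q) / 2)))) ^ 2 := by
  have hcd' : c * d ≤ c + d := by
    rw [div_add_div _ _ hc.ne' hd.ne', le_div_iff₀ (mul_pos hc hd)] at hcd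
    linarith
  have hpos (t : ℝ) : 0 < Real.sigmoid t * hypergeom c d (c + d) (Real.sigmoid t) :=
    mul_pos (Real.sigmoid_pos t)
      (hypergeom_add_pos hc hd hcd' (Real.sigmoid_pos t) (Real.sigmoid_lt_one t))
  simp only [rpow_div_one_add_rpow_eq_sigmoid hx0]
  rw [← Real.log_le_log_iff (mul_pos (hpos _) (hpos _)) (pow_pos (hpos _) 2),
    Real.log_mul (hpos _).ne' (hpos _).ne', Real.log_pow]
  have h := (concaveOn_log_mul_hypergeom_sigmoid hc hd hcd').2 (mem_univ (p * Real.log x))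
    (mem_univ (q * Real.log x)) (one_half_pos (α := ℝ)).le (one_half_pos (α := ℝ)).le
    (add_halves 1)
  have hmid : (1 / 2 : ℝ) • (p * Real.log x) + (1 / 2 : ℝ) • (q * Real.log x) =
      (p + q) / 2 * Real.log x := by
    simp only [smul_eq_mul]
    ring
  rw [hmid] at h
  simp only [smul_eq_mul] at h
  push_cast
  linarith
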